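/- arXiv:1901.05815 — 2 statements merged into one kernel-verified Lean document; each statement's English description precedes it below -/
import Mathlib

section
/- There exists a constant C > 0 (depending on κ, b̃, β, a, α₁,…,α_m, ν, μ₁,…,μ_m, but not on x) such that A₁(x) ≤ C·V₁(x) for all x ∈ D. -/
open MeasureTheory ENNReal
open scoped RealInnerProductSpace

/-- `V₁(x) = (1 + ‖x‖²)^{κ/2}` on `ℝ^d` (Euclidean norm). -/
noncomputable def V1 (d : ℕ) (κ : ℝ) (x : EuclideanSpace ℝ (Fin d)) : ℝ :=
  (1 + ‖x‖ ^ 2) ^ (κ / 2)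

/-- `∇V₁(x) = κ(1 + ‖x‖²)^{(κ−2)/2} x`. -/
noncomputable def gradV1 (d : ℕ) (κ : ℝ) (x : EuclideanSpace ℝ (Fin d)) :
    EuclideanSpace ℝ (Fin d) :=
  (κ * (1 + ‖x‖ ^ 2) ^ ((κ - 2) / 2)) • x

/-- `∂²V₁/∂x_k∂x_l(x) = κ(κ−2)x_k x_l (1 + ‖x‖²)^{(κ−4)/2} + δ_{kl} κ(1 + ‖x‖²)^{(κ−2)/2}`. -/
noncomputable def hessV1 (d : ℕ) (κ : ℝ) (x : EuclideanSpace ℝ (Fin d)) (k l : Fin d) : ℝ :=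
  κ * (κ - 2) * x k * x l * (1 + ‖x‖ ^ 2) ^ ((κ - 4) / 2) +
    (if k = l then (1:ℝ) else 0) * κ * (1 + ‖x‖ ^ 2) ^ ((κ - 2) / 2)

lemma aux_exp_quad (p : ℝ) (hp : 0 < p) : ∃ C ≥ (0:ℝ), ∀ w : ℝ, -1 < w → w ≤ 3 →
    (1 + w) ^ p ≤ 1 + p * w + C * w ^ 2 := by
  refine ⟨(Real.exp (3 * p) + 1) * p ^ 2, by positivity, fun w h1 h3 => ?_⟩
  have hpos : 0 < 1 + w := by linarith
  have hE : 0 < Real.exp (3 * p) := Real.exp_pos _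
  have h : (1 + w) ^ p ≤ Real.exp (p * w) := by
    rw [Real.rpow_def_of_pos hpos]
    apply Real.exp_le_exp.mpr
    have := Real.log_le_sub_one_of_pos hpos
    nlinarith
  refine h.trans ?_
  have key : Real.exp (p * w) ≤ 1 + p * w + (Real.exp (3 * p) + 1) * (p * w) ^ 2 := by
    have hz : p * w ≤ 3 * p := by nlinarith
    generalize p * w = z at *
    by_cases hz1 : |z| ≤ 1
    · have := (abs_le.mp (Real.abs_exp_sub_one_sub_id_le hz1)).2
      nlinarith [sq_nonneg z, mul_nonneg hE.le (sq_nonneg z)]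
    · have hz2 : 1 < z ^ 2 := by
        have : 1 < |z| := not_le.mp hz1
        rw [← sq_abs]; nlinarith
      have := Real.exp_le_exp.mpr hz
      nlinarith [sq_nonneg (z + 1), mul_le_mul_of_nonneg_left hz2.le hE.le]
  calc _ ≤ _ := key
    _ = _ := by ring

lemma aux_int_le {Ω : Type*} [MeasurableSpace Ω] (μ : Measure Ω) (f g : Ω → ℝ)
    (hg : Integrable g μ) (hg0 : 0 ≤ᵐ[μ] g) (h : f ≤ᵐ[μ] g) : ∫ x, f x ∂μ ≤ ∫ x, g x ∂μ := by
  by_cases hf : Integrable f μ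
  · exact integral_mono_ae hf hg h
  · rw [integral_undef hf]; exact integral_nonneg_of_ae hg0

lemma aux_pow_large (κ : ℝ) (hκ : 0 < κ) : ∃ C ≥ (0:ℝ), ∀ s r : ℝ, 1 ≤ s → 1 ≤ r →
    (s + r) ^ κ - s ^ κ ≤ C * s ^ (κ - 1) * (r + r ^ κ) := by
  obtain ⟨C, hC, h⟩ := aux_exp_quad κ hκ
  refine ⟨κ + C + 2 ^ κ, by positivity, fun s r hs hr => ?_⟩
  have hs0 : 0 < s := by linarith
  have hr0 : 0 < r := by linarith
  have hsk : s ^ κ = s ^ (κ - 1) * s := by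
    rw [Real.rpow_sub_one hs0.ne']; field_simp
  have hS : 0 < s ^ (κ - 1) := by positivity
  have hR : 0 < r ^ κ := by positivity
  have h2 : 0 < (2:ℝ) ^ κ := by positivity
  rcases le_total r s with hrs | hrs
  · have hu1 : r / s ≤ 1 := (div_le_one hs0).mpr hrs
    have hu0 : 0 < r / s := by positivity
    have h1 := h (r / s) (by linarith) (by linarith)
    have h3 : (1 + r / s) ^ κ ≤ 1 + (κ + C) * (r / s) := by
      nlinarith [mul_le_mul_of_nonneg_left hu1 (mul_nonneg hC hu0.le)]
    have e : (s + r) ^ κ = s ^ κ * (1 + r / s) ^ κ := by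
      rw [← Real.mul_rpow hs0.le (by positivity)]; congr 1; field_simp
    rw [e]
    calc s ^ κ * (1 + r / s) ^ κ - s ^ κ ≤ s ^ κ * (1 + (κ + C) * (r / s)) - s ^ κ := by gcongr
      _ = (κ + C) * s ^ (κ - 1) * r := by rw [hsk]; field_simp; ring
      _ ≤ _ := by
        have g1 : κ + C ≤ κ + C + 2 ^ κ := by linarith
        have g2 : r ≤ r + r ^ κ := by linarith
        exact mul_le_mul (mul_le_mul_of_nonneg_right g1 hS.le) g2 hr0.le (by positivity)
  · have h4 : (s + r) ^ κ ≤ 2 ^ κ * r ^ κ := by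
      rw [← Real.mul_rpow (by norm_num) hr0.le]
      exact Real.rpow_le_rpow (by positivity) (by linarith) hκ.le
    have h5 : r ^ κ ≤ s ^ (κ - 1) * (r + r ^ κ) := by
      rcases le_total 1 κ with h1 | h1
      · have : 1 ≤ s ^ (κ - 1) := Real.one_le_rpow hs (by linarith)
        nlinarith
      · have : r ^ (κ - 1) ≤ s ^ (κ - 1) := Real.rpow_le_rpow_of_nonpos hs0 hrs (by linarith)
        have e : r ^ κ = r ^ (κ - 1) * r := by
          rw [Real.rpow_sub_one hr0.ne']; field_simp
        nlinarith
    have : 0 < s ^ κ := by positivity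
    have h6 : 0 ≤ s ^ (κ - 1) * (r + r ^ κ) := by positivity
    have h7 := mul_nonneg (by positivity : 0 ≤ κ + C) h6
    nlinarith [mul_le_mul_of_nonneg_left h5 h2.le]

section
variable {E : Type*} [NormedAddCommGroup E] [InnerProductSpace ℝ E]

lemma aux_sq (x : E) : Real.sqrt (1 + ‖x‖ ^ 2) ^ 2 = 1 + ‖x‖ ^ 2 := Real.sq_sqrt (by positivity)

lemma aux_one_le (x : E) : 1 ≤ Real.sqrt (1 + ‖x‖ ^ 2) := by
  rw [Real.one_le_sqrt]; nlinarith [sq_nonneg ‖x‖]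

lemma aux_norm_le (x : E) : ‖x‖ ≤ Real.sqrt (1 + ‖x‖ ^ 2) := by
  apply Real.le_sqrt_of_sq_le; linarith

lemma aux_rpow (x : E) (q : ℝ) : (1 + ‖x‖ ^ 2) ^ (q / 2) = Real.sqrt (1 + ‖x‖ ^ 2) ^ q := by
  rw [Real.sqrt_eq_rpow, ← Real.rpow_mul (by positivity)]; congr 1; ring

lemma aux_bracket_add (x ξ : E) :
    Real.sqrt (1 + ‖x + ξ‖ ^ 2) ≤ Real.sqrt (1 + ‖x‖ ^ 2) + ‖ξ‖ := by
  have h1 := aux_sq x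
  have h2 := aux_one_le x
  have h3 := aux_norm_le x
  rw [Real.sqrt_le_left (by positivity)]
  have := norm_add_le x ξ
  nlinarith [norm_nonneg ξ, norm_nonneg (x + ξ), mul_le_mul_of_nonneg_right h3 (norm_nonneg ξ)]

/-- Small jumps. -/
lemma aux_small (κ : ℝ) (hκ : 0 < κ) : ∃ C ≥ (0:ℝ), ∀ x ξ : E, ‖ξ‖ ≤ 1 →
    (1 + ‖x + ξ‖ ^ 2) ^ (κ / 2) - (1 + ‖x‖ ^ 2) ^ (κ / 2)
      - ⟪ξ, (κ * (1 + ‖x‖ ^ 2) ^ ((κ - 2) / 2)) • x⟫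
      ≤ C * Real.sqrt (1 + ‖x‖ ^ 2) ^ (κ - 2) * ‖ξ‖ ^ 2 := by
  obtain ⟨C, hC, h⟩ := aux_exp_quad (κ / 2) (by positivity)
  refine ⟨κ / 2 + C * 9, by positivity, fun x ξ hξ => ?_⟩
  have hsq := aux_sq x
  have hs1 := aux_one_le x
  have hxs := aux_norm_le x
  rw [aux_rpow x κ, aux_rpow x (κ - 2), inner_smul_right]
  have hin : |⟪ξ, x⟫| ≤ ‖ξ‖ * ‖x‖ := abs_real_inner_le_norm ξ x
  have hadd : ‖x + ξ‖ ^ 2 = ‖x‖ ^ 2 + 2 * ⟪ξ, x⟫ + ‖ξ‖ ^ 2 := by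
    rw [norm_add_sq_real, real_inner_comm]
  have hr0 := norm_nonneg ξ
  have hfac : (1 + ‖x‖ ^ 2) ^ (κ / 2) = Real.sqrt (1 + ‖x‖ ^ 2) ^ κ := aux_rpow x κ
  set s := Real.sqrt (1 + ‖x‖ ^ 2) with hs
  set r := ‖ξ‖
  set t := ⟪ξ, x⟫
  have hs0 : 0 < s := by linarith
  have hpos : 0 < 1 + ‖x + ξ‖ ^ 2 := by positivity
  set w := (2 * t + r ^ 2) / s ^ 2 with hw
  have hws : w * s ^ 2 = 2 * t + r ^ 2 := by rw [hw]; field_simp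
  have e1 : 1 + ‖x + ξ‖ ^ 2 = (1 + ‖x‖ ^ 2) * (1 + w) := by
    rw [hadd, ← hsq]; linarith
  have hw1 : 0 < 1 + w := by
    rw [e1] at hpos; exact pos_of_mul_pos_right hpos (by positivity)
  have ht : |t| ≤ r * s := hin.trans (by gcongr)
  have hrs : r ≤ s := hξ.trans hs1
  have hws2 : |w * s| ≤ 3 * r := by
    have h0 : |w * s| * s ≤ 3 * r * s := by
      calc |w * s| * s = |w * s ^ 2| := by
            rw [show w * s ^ 2 = (w * s) * s by ring, abs_mul (w * s) s, abs_of_pos hs0]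
        _ = |2 * t + r ^ 2| := by rw [hws]
        _ ≤ 3 * r * s := by
            have := abs_le.mp ht
            rw [abs_le]; constructor <;> nlinarith
    exact le_of_mul_le_mul_right h0 hs0
  have hw3 : w ≤ 3 := by
    have := (abs_le.mp hws2).2
    by_contra hcon
    push Not at hcon
    nlinarith
  have hwsq : w ^ 2 * s ^ 2 ≤ 9 * r ^ 2 := by
    have := sq_le_sq' (abs_le.mp hws2).1 (abs_le.mp hws2).2
    nlinarith
  have hT := h w (by linarith) hw3
  have hP : 0 < s ^ (κ - 2) := by positivity
  have hsk : s ^ κ = s ^ (κ - 2) * s ^ 2 := by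
    rw [← Real.rpow_natCast, ← Real.rpow_add hs0]; congr 1; norm_num
  rw [e1, Real.mul_rpow (by positivity) hw1.le, hfac]
  have h8 : s ^ κ * (1 + w) ^ (κ / 2) ≤ s ^ κ * (1 + κ / 2 * w + C * w ^ 2) := by gcongr
  have h9 : s ^ κ * (1 + κ / 2 * w + C * w ^ 2)
      = s ^ κ + s ^ (κ - 2) * (κ / 2 * (w * s ^ 2) + C * (w ^ 2 * s ^ 2)) := by rw [hsk]; ring
  rw [hws] at h9
  have h10 : s ^ (κ - 2) * (C * (w ^ 2 * s ^ 2)) ≤ s ^ (κ - 2) * (C * (9 * r ^ 2)) := by gcongr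
  nlinarith

/-- Large jumps, linear compensation. -/
lemma aux_large (κ : ℝ) (hκ : 0 < κ) : ∃ C ≥ (0:ℝ), ∀ x ξ : E, 1 < ‖ξ‖ →
    (1 + ‖x + ξ‖ ^ 2) ^ (κ / 2) - (1 + ‖x‖ ^ 2) ^ (κ / 2)
      - ⟪ξ, (κ * (1 + ‖x‖ ^ 2) ^ ((κ - 2) / 2)) • x⟫
      ≤ C * Real.sqrt (1 + ‖x‖ ^ 2) ^ (κ - 1) * (‖ξ‖ + ‖ξ‖ ^ κ) := by
  obtain ⟨C, hC, h⟩ := aux_pow_large κ hκ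
  refine ⟨C + κ, by positivity, fun x ξ hξ => ?_⟩
  have hs1 := aux_one_le x
  have hxs := aux_norm_le x
  rw [aux_rpow x κ, aux_rpow (x + ξ) κ, aux_rpow x (κ - 2), inner_smul_right]
  have hin : |⟪ξ, x⟫| ≤ ‖ξ‖ * ‖x‖ := abs_real_inner_le_norm ξ x
  have h1 := h _ ‖ξ‖ hs1 hξ.le
  have h2 : Real.sqrt (1 + ‖x + ξ‖ ^ 2) ^ κ ≤ (Real.sqrt (1 + ‖x‖ ^ 2) + ‖ξ‖) ^ κ :=
    Real.rpow_le_rpow (by positivity) (aux_bracket_add x ξ) hκ.le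
  set s := Real.sqrt (1 + ‖x‖ ^ 2) with hs
  have hs0 : 0 < s := by linarith
  have hsk : s ^ (κ - 1) = s ^ (κ - 2) * s := by
    rw [← Real.rpow_add_one hs0.ne']; congr 1; ring
  have hP : 0 < s ^ (κ - 2) := by positivity
  have h3 : -⟪ξ, x⟫ ≤ ‖ξ‖ * s := (neg_le_abs _).trans (hin.trans (by gcongr))
  have h4 : -(κ * s ^ (κ - 2) * ⟪ξ, x⟫) ≤ κ * s ^ (κ - 1) * (‖ξ‖ + ‖ξ‖ ^ κ) := by
    calc _ = κ * s ^ (κ - 2) * (-⟪ξ, x⟫) := by ring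
      _ ≤ κ * s ^ (κ - 2) * (‖ξ‖ * s) := by gcongr
      _ = κ * s ^ (κ - 1) * ‖ξ‖ := by rw [hsk]; ring
      _ ≤ _ := by gcongr; have : 0 ≤ ‖ξ‖ ^ κ := by positivity
                  linarith
  nlinarith

/-- Large jumps, no compensation. -/
lemma aux_large' (κ : ℝ) (hκ : 0 < κ) (x ξ : E) (hξ : 1 < ‖ξ‖) :
    (1 + ‖x + ξ‖ ^ 2) ^ (κ / 2) ≤ 2 ^ κ * Real.sqrt (1 + ‖x‖ ^ 2) ^ κ * ‖ξ‖ ^ κ := by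
  have hs1 := aux_one_le x
  rw [aux_rpow, ← Real.mul_rpow (by norm_num) (by positivity),
    ← Real.mul_rpow (by positivity) (by positivity)]
  apply Real.rpow_le_rpow (by positivity) _ hκ.le
  refine (aux_bracket_add x ξ).trans ?_
  nlinarith [mul_nonneg (sub_nonneg.2 hs1) (sub_nonneg.2 hξ.le)]

end

lemma aux_integrable {Ω : Type*} [MeasurableSpace Ω] (μ : Measure Ω) (f g : Ω → ℝ)
    (hf : Measurable f) (hf0 : ∀ x, 0 ≤ f x)
    (hfg : ∀ᵐ x ∂μ, f x ≤ g x) (hg : ∫⁻ x, ENNReal.ofReal (g x) ∂μ ≠ ⊤) : Integrable f μ := by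
  refine ⟨hf.aestronglyMeasurable, ?_⟩
  rw [hasFiniteIntegral_iff_ofReal (Filter.Eventually.of_forall hf0)]
  refine lt_of_le_of_lt (lintegral_mono_ae ?_) (lt_top_iff_ne_top.mpr hg)
  filter_upwards [hfg] with x hx
  exact ENNReal.ofReal_le_ofReal hx

lemma aux_coord {d : ℕ} (x : EuclideanSpace ℝ (Fin d)) (k : Fin d) :
    |x k| ≤ Real.sqrt (1 + ‖x‖ ^ 2) := (PiLp.norm_apply_le x k).trans (aux_norm_le x)

lemma aux_tail_int {d : ℕ} (κ : ℝ) (ν : Measure (EuclideanSpace ℝ (Fin d)))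
    (h : ∫⁻ ξ in {ξ | 1 < ‖ξ‖}, ENNReal.ofReal (‖ξ‖ ^ κ) ∂ν ≠ ⊤) :
    Integrable (Set.indicator {ξ : EuclideanSpace ℝ (Fin d) | 1 < ‖ξ‖} (fun ξ => ‖ξ‖ ^ κ)) ν := by
  have hm : MeasurableSet {ξ : EuclideanSpace ℝ (Fin d) | 1 < ‖ξ‖} :=
    measurableSet_lt measurable_const measurable_norm
  rw [integrable_indicator_iff hm]
  exact aux_integrable _ _ (fun ξ => ‖ξ‖ ^ κ) (by fun_prop) (fun x => by positivity)
    (Filter.Eventually.of_forall fun _ => le_rfl) h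

lemma aux_drift {d : ℕ} (κ : ℝ) (hκ : 0 < κ) (b : EuclideanSpace ℝ (Fin d))
    (β : Matrix (Fin d) (Fin d) ℝ) : ∃ C ≥ (0:ℝ), ∀ x,
    ⟪b + Matrix.toEuclideanLin β x, gradV1 d κ x⟫ ≤ C * V1 d κ x := by
  set L := LinearMap.toContinuousLinearMap (Matrix.toEuclideanLin β)
  refine ⟨κ * (‖b‖ + ‖L‖), by positivity, fun x => ?_⟩
  have hs1 := aux_one_le x
  have hxs := aux_norm_le x
  unfold gradV1 V1
  rw [aux_rpow, aux_rpow, inner_smul_right]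
  have hL : ‖Matrix.toEuclideanLin β x‖ ≤ ‖L‖ * ‖x‖ := L.le_opNorm x
  set s := Real.sqrt (1 + ‖x‖ ^ 2) with hs
  have hs0 : 0 < s := by linarith
  have h1 : ⟪b + Matrix.toEuclideanLin β x, x⟫ ≤ (‖b‖ + ‖L‖) * s * s := by
    refine (real_inner_le_norm _ _).trans ?_
    have : ‖b + Matrix.toEuclideanLin β x‖ ≤ (‖b‖ + ‖L‖) * s := by
      refine (norm_add_le _ _).trans ?_
      have := mul_le_mul_of_nonneg_left hxs (norm_nonneg L)
      nlinarith [norm_nonneg b]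
    gcongr
  have hsk : s ^ κ = s ^ (κ - 2) * s ^ 2 := by
    rw [← Real.rpow_natCast, ← Real.rpow_add hs0]; congr 1; norm_num
  rw [hsk]
  calc _ ≤ κ * s ^ (κ - 2) * ((‖b‖ + ‖L‖) * s * s) := by gcongr
    _ = _ := by ring

lemma aux_hess {d : ℕ} (κ : ℝ) (hκ : 0 < κ) (x : EuclideanSpace ℝ (Fin d)) (k l : Fin d) :
    |hessV1 d κ x k l| ≤ (κ * |κ - 2| + κ) * Real.sqrt (1 + ‖x‖ ^ 2) ^ (κ - 2) := by
  have hs1 := aux_one_le x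
  have hk := aux_coord x k
  have hl := aux_coord x l
  unfold hessV1
  rw [aux_rpow, aux_rpow]
  set s := Real.sqrt (1 + ‖x‖ ^ 2) with hs
  have hs0 : 0 < s := by linarith
  have hsk : s ^ (κ - 2) = s ^ (κ - 4) * s ^ 2 := by
    rw [← Real.rpow_natCast, ← Real.rpow_add hs0]; congr 1; norm_num; ring
  have hP : 0 < s ^ (κ - 4) := by positivity
  have hP2 : 0 < s ^ (κ - 2) := by positivity
  refine (abs_add_le _ _).trans ?_
  have h1 : |κ * (κ - 2) * x k * x l * s ^ (κ - 4)| ≤ κ * |κ - 2| * s ^ (κ - 2) := by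
    rw [abs_mul, abs_mul, abs_mul, abs_mul, abs_of_pos hκ, abs_of_pos hP]
    calc _ ≤ κ * |κ - 2| * s * s * s ^ (κ - 4) := by gcongr
      _ = _ := by rw [hsk]; ring
  have h2 : |(if k = l then (1:ℝ) else 0) * κ * s ^ (κ - 2)| ≤ κ * s ^ (κ - 2) := by
    split_ifs
    · rw [one_mul, abs_of_pos (by positivity)]
    · simp; positivity
  linarith

lemma aux_diff {m n : ℕ} (κ : ℝ) (hκ : 0 < κ) (a : Matrix (Fin (m + n)) (Fin (m + n)) ℝ)
    (α : Fin m → Matrix (Fin (m + n)) (Fin (m + n)) ℝ) : ∃ C ≥ (0:ℝ), ∀ x,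
    (∑ k : Fin (m + n), ∑ l : Fin (m + n),
        (a k l + ∑ i : Fin m, α i k l * x (Fin.castAdd n i)) * hessV1 (m + n) κ x k l)
      ≤ C * V1 (m + n) κ x := by
  refine ⟨∑ k, ∑ l, (|a k l| + ∑ i, |α i k l|) * (κ * |κ - 2| + κ), by positivity, fun x => ?_⟩
  rw [Finset.sum_mul]
  refine Finset.sum_le_sum fun k _ => ?_
  rw [Finset.sum_mul]
  refine Finset.sum_le_sum fun l _ => ?_
  have hs1 := aux_one_le x
  have hH := aux_hess κ hκ x k l
  have hc := aux_coord x
  unfold V1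
  rw [aux_rpow]
  set s := Real.sqrt (1 + ‖x‖ ^ 2) with hs
  have hs0 : 0 < s := by linarith
  have h1 : |a k l + ∑ i : Fin m, α i k l * x (Fin.castAdd n i)| ≤
      (|a k l| + ∑ i, |α i k l|) * s := by
    refine (abs_add_le _ _).trans ?_
    rw [add_mul, Finset.sum_mul]
    refine add_le_add (by nlinarith [abs_nonneg (a k l)]) ?_
    refine (Finset.abs_sum_le_sum_abs _ _).trans (Finset.sum_le_sum fun i _ => ?_)
    rw [abs_mul]
    exact mul_le_mul_of_nonneg_left (hc _) (abs_nonneg _)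
  have h2 : s * s ^ (κ - 2) ≤ s ^ κ := by
    rw [mul_comm, ← Real.rpow_add_one hs0.ne']
    exact Real.rpow_le_rpow_of_exponent_le hs1 (by linarith)
  refine (le_abs_self _).trans ?_
  rw [abs_mul]
  have hn : 0 ≤ (|a k l| + ∑ i, |α i k l|) := by positivity
  calc _ ≤ ((|a k l| + ∑ i, |α i k l|) * s) * ((κ * |κ - 2| + κ) * s ^ (κ - 2)) := by gcongr
    _ = (|a k l| + ∑ i, |α i k l|) * (κ * |κ - 2| + κ) * (s * s ^ (κ - 2)) := by ring
    _ ≤ _ := by gcongr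

lemma aux_nu {d : ℕ} (κ : ℝ) (hκ : 0 < κ) (ν : Measure (EuclideanSpace ℝ (Fin d)))
    (h1 : Integrable (fun ξ : EuclideanSpace ℝ (Fin d) => min 1 (‖ξ‖ ^ 2)) ν)
    (h2 : Integrable (Set.indicator {ξ : EuclideanSpace ℝ (Fin d) | 1 < ‖ξ‖}
      (fun ξ => ‖ξ‖ ^ κ)) ν) : ∃ C ≥ (0:ℝ), ∀ x,
    (∫ ξ, (V1 d κ (x + ξ) - V1 d κ x -
        ⟪ξ, gradV1 d κ x⟫ * (if ‖ξ‖ ≤ 1 then (1:ℝ) else 0)) ∂ν) ≤ C * V1 d κ x := by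
  obtain ⟨C, hC, h⟩ := aux_small (E := EuclideanSpace ℝ (Fin d)) κ hκ
  set g : EuclideanSpace ℝ (Fin d) → ℝ := fun ξ => C * min 1 (‖ξ‖ ^ 2) +
    2 ^ κ * Set.indicator {ξ : EuclideanSpace ℝ (Fin d) | 1 < ‖ξ‖} (fun ξ => ‖ξ‖ ^ κ) ξ with hgdef
  have hg : Integrable g ν := (h1.const_mul C).add (h2.const_mul _)
  have hI : ∀ ξ, 0 ≤ Set.indicator {ξ : EuclideanSpace ℝ (Fin d) | 1 < ‖ξ‖}
      (fun ξ => ‖ξ‖ ^ κ) ξ := fun ξ => Set.indicator_nonneg (fun _ _ => by positivity) ξ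
  have hg0 : ∀ ξ, 0 ≤ g ξ := fun ξ => by have := hI ξ; positivity
  refine ⟨∫ ξ, g ξ ∂ν, integral_nonneg hg0, fun x => ?_⟩
  rw [mul_comm, ← integral_const_mul]
  have hV : 0 < V1 d κ x := by unfold V1; positivity
  refine aux_int_le ν _ _ (hg.const_mul _)
    (Filter.Eventually.of_forall fun ξ => mul_nonneg hV.le (hg0 ξ))
    (Filter.Eventually.of_forall fun ξ => ?_)
  have hs1 := aux_one_le x
  have hs0 : 0 < Real.sqrt (1 + ‖x‖ ^ 2) := by linarith
  have e : V1 d κ x = Real.sqrt (1 + ‖x‖ ^ 2) ^ κ := aux_rpow x κ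
  by_cases hξ : ‖ξ‖ ≤ 1
  · have hh := h x ξ hξ
    have hmin : min 1 (‖ξ‖ ^ 2) = ‖ξ‖ ^ 2 := min_eq_right (by nlinarith [norm_nonneg ξ])
    have hle : Real.sqrt (1 + ‖x‖ ^ 2) ^ (κ - 2) ≤ Real.sqrt (1 + ‖x‖ ^ 2) ^ κ :=
      Real.rpow_le_rpow_of_exponent_le hs1 (by linarith)
    have hn : ξ ∉ {ξ : EuclideanSpace ℝ (Fin d) | 1 < ‖ξ‖} := not_lt.mpr hξ
    simp only [hξ, if_true, mul_one, hgdef, hmin, Set.indicator_of_notMem hn]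
    refine le_trans hh ?_
    rw [e]
    calc _ ≤ C * Real.sqrt (1 + ‖x‖ ^ 2) ^ κ * ‖ξ‖ ^ 2 := by gcongr
      _ = _ := by ring
  · have hn : ξ ∈ {ξ : EuclideanSpace ℝ (Fin d) | 1 < ‖ξ‖} := not_le.mp hξ
    have hh := aux_large' κ hκ x ξ (not_le.mp hξ)
    simp only [hξ, if_false, mul_zero, hgdef, Set.indicator_of_mem hn, sub_zero]
    have h3 : V1 d κ (x + ξ) ≤ 2 ^ κ * V1 d κ x * ‖ξ‖ ^ κ := by rw [e]; exact hh
    have h4 : 0 ≤ V1 d κ x * (C * min 1 (‖ξ‖ ^ 2)) := by positivity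
    nlinarith

lemma aux_mu {d : ℕ} (κ : ℝ) (hκ : 0 < κ) (ν : Measure (EuclideanSpace ℝ (Fin d))) (k : Fin d)
    (h1 : Integrable (fun ξ : EuclideanSpace ℝ (Fin d) => min ‖ξ‖ (‖ξ‖ ^ 2)) ν)
    (h2 : Integrable (Set.indicator {ξ : EuclideanSpace ℝ (Fin d) | 1 < ‖ξ‖}
      (fun ξ => ‖ξ‖ ^ κ)) ν) : ∃ C ≥ (0:ℝ), ∀ x : EuclideanSpace ℝ (Fin d), 0 ≤ x k →
    x k * (∫ ξ, (V1 d κ (x + ξ) - V1 d κ x - ⟪ξ, gradV1 d κ x⟫) ∂ν) ≤ C * V1 d κ x := by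
  obtain ⟨C, hC, h⟩ := aux_small (E := EuclideanSpace ℝ (Fin d)) κ hκ
  obtain ⟨C', hC', h'⟩ := aux_large (E := EuclideanSpace ℝ (Fin d)) κ hκ
  set g : EuclideanSpace ℝ (Fin d) → ℝ := fun ξ => (C + C') * (min ‖ξ‖ (‖ξ‖ ^ 2) +
    Set.indicator {ξ : EuclideanSpace ℝ (Fin d) | 1 < ‖ξ‖} (fun ξ => ‖ξ‖ ^ κ) ξ) with hgdef
  have hg : Integrable g ν := (h1.add h2).const_mul _
  have hI : ∀ ξ, 0 ≤ Set.indicator {ξ : EuclideanSpace ℝ (Fin d) | 1 < ‖ξ‖}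
      (fun ξ => ‖ξ‖ ^ κ) ξ := fun ξ => Set.indicator_nonneg (fun _ _ => by positivity) ξ
  have hg0 : ∀ ξ, 0 ≤ g ξ := fun ξ => by have := hI ξ; positivity
  refine ⟨∫ ξ, g ξ ∂ν, integral_nonneg hg0, fun x hx => ?_⟩
  have hs1 := aux_one_le x
  have hxk := (le_abs_self _).trans (aux_coord x k)
  have e : V1 d κ x = Real.sqrt (1 + ‖x‖ ^ 2) ^ κ := aux_rpow x κ
  have key : (∫ ξ, (V1 d κ (x + ξ) - V1 d κ x - ⟪ξ, gradV1 d κ x⟫) ∂ν) ≤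
      Real.sqrt (1 + ‖x‖ ^ 2) ^ (κ - 1) * ∫ ξ, g ξ ∂ν := by
    rw [← integral_const_mul]
    refine aux_int_le ν _ _ (hg.const_mul _)
      (Filter.Eventually.of_forall fun ξ => mul_nonneg (by positivity) (hg0 ξ))
      (Filter.Eventually.of_forall fun ξ => ?_)
    have hP : 0 < Real.sqrt (1 + ‖x‖ ^ 2) ^ (κ - 1) := by positivity
    by_cases hξ : ‖ξ‖ ≤ 1
    · have hmin : min ‖ξ‖ (‖ξ‖ ^ 2) = ‖ξ‖ ^ 2 := min_eq_right (by nlinarith [norm_nonneg ξ])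
      have hle : Real.sqrt (1 + ‖x‖ ^ 2) ^ (κ - 2) ≤ Real.sqrt (1 + ‖x‖ ^ 2) ^ (κ - 1) :=
        Real.rpow_le_rpow_of_exponent_le hs1 (by linarith)
      have hn : ξ ∉ {ξ : EuclideanSpace ℝ (Fin d) | 1 < ‖ξ‖} := not_lt.mpr hξ
      simp only [hgdef, hmin, Set.indicator_of_notMem hn]
      refine le_trans (h x ξ hξ) ?_
      calc _ ≤ (C + C') * Real.sqrt (1 + ‖x‖ ^ 2) ^ (κ - 1) * ‖ξ‖ ^ 2 := by gcongr; linarith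
        _ = _ := by ring
    · have hξ' := not_le.mp hξ
      have hmin : min ‖ξ‖ (‖ξ‖ ^ 2) = ‖ξ‖ := min_eq_left (by nlinarith [norm_nonneg ξ])
      have hn : ξ ∈ {ξ : EuclideanSpace ℝ (Fin d) | 1 < ‖ξ‖} := hξ'
      simp only [hgdef, hmin, Set.indicator_of_mem hn]
      refine le_trans (h' x ξ hξ') ?_
      calc _ ≤ (C + C') * Real.sqrt (1 + ‖x‖ ^ 2) ^ (κ - 1) * (‖ξ‖ + ‖ξ‖ ^ κ) := by
            gcongr; linarith
        _ = _ := by ring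
  have hG : 0 ≤ ∫ ξ, g ξ ∂ν := integral_nonneg hg0
  set s := Real.sqrt (1 + ‖x‖ ^ 2) with hs
  have hs0 : 0 < s := by linarith
  have hsk : s ^ κ = s ^ (κ - 1) * s := by
    rw [← Real.rpow_add_one hs0.ne']; congr 1; ring
  calc _ ≤ x k * (s ^ (κ - 1) * ∫ ξ, g ξ ∂ν) := mul_le_mul_of_nonneg_left key hx
    _ ≤ s * (s ^ (κ - 1) * ∫ ξ, g ξ ∂ν) := by gcongr
    _ = _ := by rw [e, hsk]; ring

/-- There is a constant `C > 0` (depending on `κ, b̃, β, a, α, ν, μ` but not on `x`) such that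
`A₁(x) ≤ C·V₁(x)` for all `x` in the canonical state space `D = ℝ₊^m × ℝ^n`, where
`A₁(x) = ⟨b̃ + βx, ∇V₁(x)⟩ + Σ_{k,l} (a_{kl} + Σ_i α_{i,kl} x_i) ∂²V₁/∂x_k∂x_l(x)
 + ∫_D (V₁(x+ξ) − V₁(x) − ⟨ξ, ∇V₁(x)⟩·1_{‖ξ‖≤1}) ν(dξ)
 + Σ_i x_i ∫_D (V₁(x+ξ) − V₁(x) − ⟨ξ, ∇V₁(x)⟩) μ_i(dξ)`,
`ν` and the `μ_i` are Borel measures supported on `D`, vanishing on `{0}`, with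
`∫_D (1 ∧ ‖ξ‖² + Σ_i (1 ∧ ξ_i)) ν(dξ) < ∞`, `∫_{‖ξ‖>1} ‖ξ‖^κ ν(dξ) < ∞`,
`∫_D (‖ξ‖ ∧ ‖ξ‖² + Σ_{k≠i} ξ_k) μ_i(dξ) < ∞` and `∫_{‖ξ‖>1} ‖ξ‖^κ μ_i(dξ) < ∞`. -/
theorem A1_le_const_mul_V1 (m n : ℕ) (hd : 0 < m + n) (κ : ℝ) (hκ : 0 < κ)
    (btil : EuclideanSpace ℝ (Fin (m + n)))
    (β a : Matrix (Fin (m + n)) (Fin (m + n)) ℝ)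
    (α : Fin m → Matrix (Fin (m + n)) (Fin (m + n)) ℝ)
    (ν : Measure (EuclideanSpace ℝ (Fin (m + n))))
    (μ : Fin m → Measure (EuclideanSpace ℝ (Fin (m + n))))
    (Dset : Set (EuclideanSpace ℝ (Fin (m + n))))
    (hDset : Dset = {x | ∀ i : Fin m, 0 ≤ x (Fin.castAdd n i)})
    (hν0 : ν {0} = 0) (hνD : ν Dsetᶜ = 0)
    (hν1 : ∫⁻ ξ, ENNReal.ofReal
        (min 1 (‖ξ‖ ^ 2) + ∑ i : Fin m, min 1 (ξ (Fin.castAdd n i))) ∂ν ≠ ⊤)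
    (hν2 : ∫⁻ ξ in {ξ | 1 < ‖ξ‖}, ENNReal.ofReal (‖ξ‖ ^ κ) ∂ν ≠ ⊤)
    (hμ0 : ∀ i, μ i {0} = 0) (hμD : ∀ i, (μ i) Dsetᶜ = 0)
    (hμ1 : ∀ i, ∫⁻ ξ, ENNReal.ofReal
        (min ‖ξ‖ (‖ξ‖ ^ 2) +
          ∑ k ∈ Finset.univ.erase i, ξ (Fin.castAdd n k)) ∂(μ i) ≠ ⊤)
    (hμ2 : ∀ i, ∫⁻ ξ in {ξ | 1 < ‖ξ‖}, ENNReal.ofReal (‖ξ‖ ^ κ) ∂(μ i) ≠ ⊤)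
    (A1 : EuclideanSpace ℝ (Fin (m + n)) → ℝ)
    (hA1 : ∀ x, A1 x =
      ⟪btil + Matrix.toEuclideanLin β x, gradV1 (m + n) κ x⟫ +
      (∑ k : Fin (m + n), ∑ l : Fin (m + n),
        (a k l + ∑ i : Fin m, α i k l * x (Fin.castAdd n i)) * hessV1 (m + n) κ x k l) +
      (∫ ξ, (V1 (m + n) κ (x + ξ) - V1 (m + n) κ x -
        ⟪ξ, gradV1 (m + n) κ x⟫ * (if ‖ξ‖ ≤ 1 then (1:ℝ) else 0)) ∂ν) +
      ∑ i : Fin m, x (Fin.castAdd n i) *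
        ∫ ξ, (V1 (m + n) κ (x + ξ) - V1 (m + n) κ x - ⟪ξ, gradV1 (m + n) κ x⟫) ∂(μ i)) :
    ∃ C > (0:ℝ), ∀ x ∈ Dset, A1 x ≤ C * V1 (m + n) κ x := by
  have hDν : ∀ᵐ ξ ∂ν, ∀ i : Fin m, 0 ≤ ξ (Fin.castAdd n i) := by
    rw [hDset] at hνD; exact hνD
  have hDμ : ∀ j, ∀ᵐ ξ ∂(μ j), ∀ i : Fin m, 0 ≤ ξ (Fin.castAdd n i) := by
    intro j; have := hμD j; rw [hDset] at this; exact this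
  have hνi := aux_integrable ν (fun ξ => min 1 (‖ξ‖ ^ 2)) _ (by fun_prop)
    (fun ξ => by positivity) (by
      filter_upwards [hDν] with ξ hξ
      exact le_add_of_nonneg_right (Finset.sum_nonneg fun i _ => le_min zero_le_one (hξ i))) hν1
  have hμi := fun j => aux_integrable (μ j) (fun ξ => min ‖ξ‖ (‖ξ‖ ^ 2)) _ (by fun_prop)
    (fun ξ => by positivity) (by
      filter_upwards [hDμ j] with ξ hξ
      exact le_add_of_nonneg_right (Finset.sum_nonneg fun i _ => hξ i)) (hμ1 j)
  obtain ⟨C1, hC1, H1⟩ := aux_drift κ hκ btil β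
  obtain ⟨C2, hC2, H2⟩ := aux_diff κ hκ a α
  obtain ⟨C3, hC3, H3⟩ := aux_nu κ hκ ν hνi (aux_tail_int κ ν hν2)
  choose C4 hC4 H4 using fun j : Fin m =>
    aux_mu κ hκ (μ j) (Fin.castAdd n j) (hμi j) (aux_tail_int κ (μ j) (hμ2 j))
  have hsum : 0 ≤ ∑ j, C4 j := Finset.sum_nonneg fun j _ => hC4 j
  refine ⟨C1 + C2 + C3 + ∑ j, C4 j + 1, by linarith, fun x hx => ?_⟩
  rw [hDset] at hx
  have hV : 0 < V1 (m + n) κ x := by unfold V1; positivity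
  have H5 := Finset.sum_le_sum fun j (_ : j ∈ Finset.univ) => H4 j x (hx j)
  rw [← Finset.sum_mul] at H5
  rw [hA1 x]
  have := H1 x
  have := H2 x
  have := H3 x
  linarith
end

section
/- Let x, ξ ∈ ℝ^d and let i ∈ {1,…,d} be an index such that x_i ≥ 0 and ξ_i ≥ 0. Then x_i·(log(1 + ‖x + ξ‖²) − log(1 + ‖x‖²)) ≤ 2‖ξ‖. -/
/-- Let `x, ξ ∈ ℝ^d` (Euclidean norm) and `i` an index with `x_i ≥ 0` and `ξ_i ≥ 0`. Then
`x_i·(log(1 + ‖x + ξ‖²) − log(1 + ‖x‖²)) ≤ 2‖ξ‖`. -/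
theorem coord_mul_V2_diff_le (d : ℕ) (hd : 1 ≤ d) (x ξ : EuclideanSpace ℝ (Fin d))
    (i : Fin d) (hx : 0 ≤ x i) (hξ : 0 ≤ ξ i) :
    x i * (Real.log (1 + ‖x + ξ‖ ^ 2) - Real.log (1 + ‖x‖ ^ 2)) ≤ 2 * ‖ξ‖ := by
  have hc : x i ≤ ‖x‖ := (le_abs_self _).trans (PiLp.norm_apply_le x i)
  have ht := norm_nonneg ξ
  rcases hx.eq_or_lt with h0 | h0
  · rw [← h0]; linarith
  obtain ⟨s, hs⟩ : ∃ s, s = ‖ξ‖ / x i := ⟨_, rfl⟩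
  have hs0 : 0 ≤ s := by rw [hs]; positivity
  have hsc : ‖ξ‖ = x i * s := by rw [hs]; field_simp
  have h1 : ‖x + ξ‖ ≤ ‖x‖ * (1 + s) := by
    have := norm_add_le x ξ
    nlinarith [mul_le_mul_of_nonneg_right hc hs0]
  have h2 : 1 + ‖x + ξ‖ ^ 2 ≤ (1 + ‖x‖ ^ 2) * (1 + s) ^ 2 := by
    have := pow_le_pow_left₀ (norm_nonneg _) h1 2
    nlinarith [sq_nonneg s]
  have h3 := Real.log_le_log (by positivity) h2
  rw [Real.log_mul (by positivity) (by positivity), Real.log_pow] at h3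
  have h4 := Real.log_le_sub_one_of_pos (show 0 < 1 + s by positivity)
  push_cast at h3
  rw [hsc]
  have h5 : Real.log (1 + ‖x + ξ‖ ^ 2) - Real.log (1 + ‖x‖ ^ 2) ≤ 2 * s := by linarith
  linarith [mul_le_mul_of_nonneg_left h5 hx]
end
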